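/- arXiv:2211.06887 — 8 statements merged into one kernel-verified Lean document; each statement's English description precedes it below -/
import Mathlib

section
/- Let F and W be finite disjoint sets (firms and workers), and for each f ∈ F let ℬ_f ⊆ 2^W \ {∅} be a collection of worker sets. Suppose there exists a technology roadmap over W such that (i) every worker w ∈ W is a specialist in the roadmap, and (ii) there exist technology paths {P^f}_{f∈F} with pairwise disjoint vertex sets such that for every f ∈ F, every S ∈ ℬ_f equals W^v for some vertex v of P^f. Then the hypergraph with vertex set F ∪ W and edge set {{f} ∪ S : f ∈ F, S ∈ ℬ_f} has no nontrivial odd-length cycle. -/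
open Finset


/-- A cycle of length `k` in a hypergraph with edge predicate `edges`:
a cyclic alternating sequence of `k` distinct vertices `j 0, …, j (k-1)` and
`k` distinct edges `E 0, …, E (k-1)` with `j i ∈ E i` and `j (i+1) ∈ E i`
(indices modulo `k`), where `k ≥ 2`. -/
def IsCycle {V : Type*} (edges : Finset V → Prop) (k : ℕ)
    (j : ZMod k → V) (E : ZMod k → Finset V) : Prop :=
  2 ≤ k ∧ Function.Injective j ∧ Function.Injective E ∧
    (∀ i, edges (E i)) ∧ (∀ i, j i ∈ E i ∧ j (i + 1) ∈ E i)

/-- A nontrivial odd-length cycle: a cycle of odd length such that every edge `E i`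
of the cycle contains exactly two of the cycle's vertices; since `j i` and `j (i+1)`
are two distinct cycle vertices belonging to `E i`, this says that the only cycle
vertices in `E i` are `j i` and `j (i+1)`. -/
def IsNontrivialOddCycle {V : Type*} (edges : Finset V → Prop) (k : ℕ)
    (j : ZMod k → V) (E : ZMod k → Finset V) : Prop :=
  IsCycle edges k j E ∧ Odd k ∧ ∀ i t : ZMod k, j t ∈ E i → t = i ∨ t = i + 1

/-- The hypergraph with edge predicate `edges` has some nontrivial odd-length cycle. -/
def HasNontrivialOddCycle {V : Type*} (edges : Finset V → Prop) : Prop :=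
  ∃ (k : ℕ) (j : ZMod k → V) (E : ZMod k → Finset V),
    IsNontrivialOddCycle edges k j E

/-- A technology roadmap over a worker set `W`: a directed tree `(V, E)` (a directed
graph, loopless and with no two-cycles, whose underlying undirected graph is a tree)
together with an assignment `tech v ⊆ W` of the workers demanded by each technology `v`. -/
structure Roadmap (W : Type*) [DecidableEq W] where
  V : Type
  [fintypeV : Fintype V]
  [decEqV : DecidableEq V]
  E : V → V → Prop
  irrefl : ∀ v, ¬ E v v
  antisymm : ∀ u v, E u v → ¬ E v u
  tree : (SimpleGraph.fromRel E).IsTree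
  tech : V → Finset W

/-- `Vs` is the vertex set of a technology path of the roadmap: either a single vertex
or a directed path `c 0 → c 1 → ⋯ → c n` (all edges oriented in the same direction). -/
def Roadmap.IsPathOn {W : Type*} [DecidableEq W] (R : Roadmap W) (Vs : Set R.V) : Prop :=
  ∃ (n : ℕ) (c : Fin (n + 1) → R.V), Function.Injective c ∧ Vs = Set.range c ∧
    ∀ i : Fin n, R.E (c i.castSucc) (c i.succ)

/-- Worker `w` is a specialist: the subgraph `G^w` with vertex set `{v | w ∈ tech v}` and
the induced directed edges is a technology path (a single vertex or a directed path). -/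
def Roadmap.IsSpecialist {W : Type*} [DecidableEq W] (R : Roadmap W) (w : W) : Prop :=
  ∃ (n : ℕ) (c : Fin (n + 1) → R.V), Function.Injective c ∧
    {v | w ∈ R.tech v} = Set.range c ∧
    (∀ i : Fin n, R.E (c i.castSucc) (c i.succ)) ∧
    (∀ u v, w ∈ R.tech u → w ∈ R.tech v → R.E u v →
      ∃ i : Fin n, u = c i.castSucc ∧ v = c i.succ)

/-- On an acyclic connected graph, every symmetric `ZMod 2`-valued edge labelling is the
coboundary of a vertex labelling. -/
theorem SimpleGraph.IsTree.exists_potential {V : Type*} {G : SimpleGraph V} (hG : G.IsTree)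
    (g : V → V → ZMod 2) (hg : ∀ u v, g u v = g v u) :
    ∃ φ : V → ZMod 2, ∀ u v, G.Adj u v → φ v = φ u + g u v := by
  classical
  obtain ⟨r⟩ := hG.connected.nonempty
  choose p hp using fun v => (hG.existsUnique_path r v).exists
  have hu : ∀ v (q : G.Walk r v), q.IsPath → q = p v := fun v q hq =>
    (hG.existsUnique_path r v).unique hq (hp v)
  let s : ∀ {v : V}, G.Walk r v → ZMod 2 := fun q => (q.darts.map fun d => g d.fst d.snd).sum
  have hs : ∀ u v, G.Adj u v → v ∉ (p u).support → s (p v) = s (p u) + g u v := by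
    intro u v h hv
    rw [← hu v _ ((hp u).concat hv h)]
    simp [s, SimpleGraph.Walk.darts_concat]
  refine ⟨fun v => s (p v), fun u v h => ?_⟩
  by_cases hv : v ∈ (p u).support
  · have hnu : u ∉ (p v).support :=
      hG.isAcyclic.ne_mem_support_of_support_of_adj_of_isPath (hp u) (hp v) h hv
    have := hs v u h.symm hnu
    change s (p v) = s (p u) + g u v
    rw [this, hg u v, add_assoc, CharTwo.add_self_eq_zero, add_zero]
  · exact hs u v h hv

/-- If `φ` changes along an edge exactly when the tail of the edge is marked, then `φ` changes
between two marked vertices of a directed path that has no other marked vertices. -/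
theorem potential_add_one_of_path {V : Type*} {E : V → V → Prop} {M : Set V} {φ : V → ZMod 2}
    (hM : ∀ u v, E u v → u ∈ M → φ v = φ u + 1) (hN : ∀ u v, E u v → u ∉ M → φ v = φ u)
    {n : ℕ} {c : Fin (n + 1) → V}
    (hE : ∀ i : Fin n, E (c i.castSucc) (c i.succ)) {a b : Fin (n + 1)} (hab : a < b)
    (ha : c a ∈ M) (honly : ∀ i, c i ∈ M → i = a ∨ i = b) : φ (c b) = φ (c a) + 1 := by
  obtain ⟨a, han⟩ := a
  obtain ⟨b, hbn⟩ := b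
  simp only [Fin.mk_lt_mk] at hab
  have key : ∀ m (hm : m < n + 1), a + 1 ≤ m → m ≤ b → φ (c ⟨m, hm⟩) = φ (c ⟨a, han⟩) + 1 := by
    intro m hm ham
    induction m, ham using Nat.le_induction with
    | base => exact fun _ => hM _ _ (hE ⟨a, by omega⟩) ha
    | succ m ham ih =>
      intro hmb
      rw [← ih (by omega) (by omega)]
      refine hN _ _ (hE ⟨m, by omega⟩) fun hmem => ?_
      have := honly _ hmem
      simp only [Fin.mk.injEq] at this
      omega
  exact key b hbn hab le_rfl

/-- The vertex-path incidence structure of a directed tree has no nontrivial odd cycle. -/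
theorem Roadmap.not_odd_of_cyclic_paths {W : Type*} [DecidableEq W] (R : Roadmap W) {k : ℕ}
    [NeZero k] (v : ZMod k → R.V) (hv : Function.Injective v) (hk : 2 ≤ k)
    (Q : ZMod k → Set R.V) (hQ : ∀ i, R.IsPathOn (Q i))
    (hmem : ∀ i t, v i ∈ Q t ↔ t = i ∨ t = i + 1) : ¬ Odd k := by
  classical
  have : Fact (1 < k) := ⟨hk⟩
  obtain ⟨φ, hφ⟩ := R.tree.exists_potential
    (fun x y => if (R.E x y ∧ x ∈ Set.range v) ∨ (R.E y x ∧ y ∈ Set.range v) then 1 else 0)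
    (fun x y => by simp only [or_comm])
  have hadj : ∀ x y, R.E x y → (SimpleGraph.fromRel R.E).Adj x y := fun x y h =>
    (SimpleGraph.fromRel_adj _ _ _).2 ⟨fun hxy => R.irrefl x (by rwa [← hxy] at h), Or.inl h⟩
  have hM : ∀ x y, R.E x y → x ∈ Set.range v → φ y = φ x + 1 := by
    intro x y h hx
    rw [hφ x y (hadj x y h), if_pos (Or.inl ⟨h, hx⟩)]
  have hN : ∀ x y, R.E x y → x ∉ Set.range v → φ y = φ x := by
    intro x y h hx
    rw [hφ x y (hadj x y h), if_neg, add_zero]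
    rintro (h' | h')
    · exact hx h'.2
    · exact R.antisymm _ _ h h'.1
  have step : ∀ i, φ (v (i + 1)) = φ (v i) + 1 := by
    intro i
    obtain ⟨n, c, hc, hrange, hE⟩ := hQ (i + 1)
    obtain ⟨a, ha⟩ : v i ∈ Set.range c := hrange ▸ (hmem _ _).2 (Or.inr rfl)
    obtain ⟨b, hb⟩ : v (i + 1) ∈ Set.range c := hrange ▸ (hmem _ _).2 (Or.inl rfl)
    have honly : ∀ l, c l ∈ Set.range v → l = a ∨ l = b := by
      rintro l ⟨t, ht⟩
      have : v t ∈ Q (i + 1) := by rw [hrange, ht]; exact ⟨l, rfl⟩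
      rcases (hmem _ _).1 this with h | h
      · right; apply hc; rw [hb, ← ht, h]
      · left; apply hc; rw [ha, ← ht, add_right_cancel h]
    have hne : a ≠ b := by
      rintro rfl
      have := hv (ha.symm.trans hb)
      simp at this
    rw [← ha, ← hb]
    rcases hne.lt_or_gt with hab | hab
    · exact potential_add_one_of_path hM hN hE hab ⟨i, ha.symm⟩ honly
    · rw [potential_add_one_of_path hM hN hE hab ⟨_, hb.symm⟩ fun l hl => (honly l hl).symm,
        add_assoc, CharTwo.add_self_eq_zero, add_zero]
  have hsum : ∑ i, φ (v (i + 1)) = ∑ i, φ (v i) :=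
    Equiv.sum_comp (Equiv.addRight (1 : ZMod k)) fun i => φ (v i)
  simp only [step, sum_add_distrib, sum_const, card_univ, ZMod.card, nsmul_eq_mul, mul_one, add_eq_left] at hsum
  rw [Nat.not_odd_iff_even]
  exact (ZMod.natCast_eq_zero_iff_even).1 hsum

/-- If there is a technology roadmap over `W` in which every worker is a
specialist, and there are technology paths `P f` with pairwise disjoint vertex sets such
that every `S ∈ ℬ f` equals the demanded worker set of some vertex of `P f`, then the
hypergraph with vertex set `F ⊕ W` and edges `{f} ∪ S` for `S ∈ ℬ f` has no nontrivial
odd-length cycle. -/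
theorem stmt3 {F W : Type*} [Fintype F] [Fintype W] [DecidableEq F] [DecidableEq W]
    (B : F → Finset (Finset W)) (hB : ∀ f, ∀ S ∈ B f, S.Nonempty)
    (R : Roadmap W)
    (hspec : ∀ w : W, R.IsSpecialist w)
    (P : F → Set R.V)
    (hpath : ∀ f, R.IsPathOn (P f))
    (hdisj : ∀ f f', f ≠ f' → Disjoint (P f) (P f'))
    (hacc : ∀ f, ∀ S ∈ B f, ∃ v ∈ P f, S = R.tech v) :
    ¬ HasNontrivialOddCycle
      (fun e : Finset (F ⊕ W) =>
        ∃ f S, S ∈ B f ∧ e = insert (Sum.inl f) (S.image Sum.inr)) := by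
  rintro ⟨k, j, E, ⟨hk, hj, hE, hedge, hinc⟩, hodd, htwo⟩
  have : NeZero k := ⟨by omega⟩
  choose f S hS hEq using hedge
  choose v hvP hSv using fun i => hacc (f i) (S i) (hS i)
  have hf : ∀ i g, v i ∈ P g → g = f i := by
    intro i g h
    by_contra hne
    exact Set.disjoint_left.1 (hdisj _ _ hne) h (hvP i)
  let Q : F ⊕ W → Set R.V := Sum.elim P fun w => {x | w ∈ R.tech x}
  have hQpath : ∀ x, R.IsPathOn (Q x) := by
    rintro (g | w)
    · exact hpath g
    · obtain ⟨n, c, hc, hr, hedges, -⟩ := hspec w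
      exact ⟨n, c, hc, hr, hedges⟩
  have hQmem : ∀ i x, v i ∈ Q x ↔ x ∈ E i := by
    rintro i (g | w)
    · simp only [Q, hEq, Sum.elim_inl, mem_insert, mem_image, Sum.inl.injEq, reduceCtorEq,
        and_false, exists_false, or_false]
      exact ⟨hf i g, fun h => h ▸ hvP i⟩
    · simp [Q, hEq, hSv]
  have hv : Function.Injective v := by
    intro a b hab
    have hfab : f a = f b := hf b (f a) (hab ▸ hvP a)
    exact hE (by rw [hEq, hEq, hfab, hSv, hSv, hab])
  refine R.not_odd_of_cyclic_paths v hv hk (fun t => Q (j t)) (fun t => hQpath _)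
    (fun i t => ⟨fun h => htwo i t ((hQmem _ _).1 h), ?_⟩) hodd
  rintro (rfl | rfl)
  · exact (hQmem _ _).2 (hinc _).1
  · exact (hQmem _ _).2 (hinc _).2
end

section
/- Let a discrete many-to-one matching market be given, and suppose the firms' demand type 𝒟 is totally unimodular. Then the firm-worker hypergraph of the market contains no nontrivial odd-length cycle with the property that for each firm f and each pair of sets S, S′ such that both {f} ∪ S and {f} ∪ S′ are edges of the cycle, either S = Ch_f(S ∪ S′) or S′ = Ch_f(S ∪ S′). -/
open Finset


/-- The set of workers assigned to firm `f` by the assignment `μ`. -/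
def assignedSet {F W : Type*} [Fintype W] [DecidableEq F] (μ : W → Option F) (f : F) :
    Finset W :=
  Finset.univ.filter fun w => μ w = some f

/-- A discrete many-to-one matching market: firms `F`, workers `W`; each worker `w`
has a strict (total) preference `pw w` over `Option F` (`none` = unmatched); each firm
`f` has a strict (total) preference `pf f` over subsets of `W`; `Ch f S` is the
`pf f`-maximal subset of `S`. Here `pw w a b` (resp. `pf f A B`) means `a ≻_w b`
(resp. `A ≻_f B`). -/
structure DMarket (F W : Type*) [Fintype W] [DecidableEq F] [DecidableEq W] where
  pw : W → Option F → Option F → Prop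
  pw_sto : ∀ w, IsStrictTotalOrder (Option F) (pw w)
  pf : F → Finset W → Finset W → Prop
  pf_sto : ∀ f, IsStrictTotalOrder (Finset W) (pf f)
  Ch : F → Finset W → Finset W
  Ch_subset : ∀ f S, Ch f S ⊆ S
  Ch_max : ∀ f S S', S' ⊆ S → S' ≠ Ch f S → pf f (Ch f S) S'

namespace DMarket

variable {F W : Type*} [Fintype W] [DecidableEq F] [DecidableEq W]

/-- `S` is satisfactory to firm `f`: `S` is nonempty and `Ch f S = S`. -/
def Satisf (M : DMarket F W) (f : F) (S : Finset W) : Prop :=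
  S.Nonempty ∧ M.Ch f S = S

/-- Individual rationality of a matching `μ`: every worker weakly prefers her match to
being unmatched, and every firm chooses its whole assigned set. -/
def IndivRat (M : DMarket F W) (μ : W → Option F) : Prop :=
  (∀ w, μ w = none ∨ M.pw w (μ w) none) ∧
  (∀ f, M.Ch f (assignedSet μ f) = assignedSet μ f)

/-- `(f, S)` is a blocking coalition for `μ`: every worker in `S` weakly prefers `f` to
her current match, and `f` strictly prefers `S` to its current assigned set. -/
def Blocks (M : DMarket F W) (μ : W → Option F) (f : F) (S : Finset W) : Prop :=
  (∀ w ∈ S, μ w = some f ∨ M.pw w (some f) (μ w)) ∧ M.pf f S (assignedSet μ f)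

/-- Stability of a matching `μ` in a discrete matching market. -/
def Stable (M : DMarket F W) (μ : W → Option F) : Prop :=
  M.IndivRat μ ∧ ¬ ∃ f S, M.Blocks μ f S

/-- The firm-worker hypergraph of a discrete market: vertices `F ⊕ W`, and an edge
`{f} ∪ S` for each firm `f` and each satisfactory set `S` of `f`. -/
def fwEdges (M : DMarket F W) (e : Finset (F ⊕ W)) : Prop :=
  ∃ f S, M.Satisf f S ∧ e = insert (Sum.inl f) (S.image Sum.inr)

end DMarket

/-- The property of a cycle (given by its edges `E`) that for each firm `f` and each pair
`S, S'` such that both `{f} ∪ S` and `{f} ∪ S'` are edges of the cycle, either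
`S = Ch f (S ∪ S')` or `S' = Ch f (S ∪ S')`. -/
def DMarket.ChPropCycle {F W : Type*} [Fintype W] [DecidableEq F] [DecidableEq W]
    (M : DMarket F W) {k : ℕ} (E : ZMod k → Finset (F ⊕ W)) : Prop :=
  ∀ (f : F) (S S' : Finset W),
    (∃ i, E i = insert (Sum.inl f) (S.image Sum.inr)) →
    (∃ i, E i = insert (Sum.inl f) (S'.image Sum.inr)) →
    M.Ch f (S ∪ S') = S ∨ M.Ch f (S ∪ S') = S'

/-- The indicator vector `χ_S ∈ {0,1}^W` of a finite set `S ⊆ W`, as an integer vector. -/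
def indicatorVec {W : Type*} [DecidableEq W] (S : Finset W) : W → ℤ :=
  fun w => if w ∈ S then 1 else 0

/-- The firms' demand type `𝒟 = ∪_f 𝒟_f`, where
`𝒟_f = {d ≠ 0 | d = χ_{Ch f S} − χ_{Ch f S'} for some S' ⊂ S ⊆ W}`. -/
def DMarket.demandType {F W : Type*} [Fintype W] [DecidableEq F] [DecidableEq W]
    (M : DMarket F W) : Set (W → ℤ) :=
  {d | d ≠ 0 ∧ ∃ (f : F) (S S' : Finset W), S' ⊂ S ∧
    d = indicatorVec (M.Ch f S) - indicatorVec (M.Ch f S')}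

/-- A set of vectors is totally unimodular if the matrix having these vectors as columns
is totally unimodular. -/
def TotallyUnimodularFamily {W : Type*} (D : Set (W → ℤ)) : Prop :=
  (Matrix.of fun (w : W) (d : D) => (d : W → ℤ) w).IsTotallyUnimodular

theorem indicatorVec_apply {W : Type*} [DecidableEq W] (S : Finset W) (w : W) :
    indicatorVec S w = if w ∈ S then 1 else 0 := rfl

theorem indicatorVec_injective {W : Type*} [DecidableEq W] :
    Function.Injective (indicatorVec : Finset W → W → ℤ) := by
  intro S T h
  ext w
  have hw := congrFun h w
  simp only [indicatorVec_apply] at hw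
  split_ifs at hw <;> simp_all

theorem DMarket.indicatorVec_mem_demandType {F W : Type*} [Fintype W] [DecidableEq F]
    [DecidableEq W] (M : DMarket F W) {f : F} {S : Finset W} (hS : M.Satisf f S) :
    indicatorVec S ∈ M.demandType := by
  have h0 : M.Ch f ∅ = ∅ := Finset.subset_empty.1 (M.Ch_subset f ∅)
  have hz : indicatorVec (∅ : Finset W) = 0 := by ext; simp [indicatorVec_apply]
  refine ⟨fun h => hS.1.ne_empty (indicatorVec_injective (h.trans hz.symm)),
    f, S, ∅, hS.1.empty_ssubset, ?_⟩
  rw [hS.2, h0, hz, sub_zero]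

theorem DMarket.indicatorVec_sub_mem_demandType {F W : Type*} [Fintype W] [DecidableEq F]
    [DecidableEq W] (M : DMarket F W) {f : F} {S T : Finset W} (hT : M.Ch f T = T)
    (hne : S ≠ T) (h : M.Ch f (S ∪ T) = S) :
    indicatorVec S - indicatorVec T ∈ M.demandType := by
  refine ⟨fun h0 => hne (indicatorVec_injective (sub_eq_zero.1 h0)), f, S ∪ T, T,
    Finset.subset_union_right.ssubset_of_ne fun hu => ?_, by rw [h, hT]⟩
  rw [← hu, hT] at h
  exact hne h.symm

/-- A function on a cycle of odd length that changes sign at every step vanishes. -/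
theorem eq_zero_of_forall_add_one_eq_neg {k : ℕ} (hk : Odd k) (z : ZMod k → ℤ)
    (hz : ∀ i, z (i + 1) = -z i) (i : ZMod k) : z i = 0 := by
  have h : ∀ n : ℕ, z (i + n) = (-1) ^ n * z i := by
    intro n
    induction n with
    | zero => simp
    | succ n ih => rw [Nat.cast_succ, ← add_assoc, hz, ih, pow_succ]; ring
  have hk' := h k
  rw [ZMod.natCast_self, add_zero, hk.neg_one_pow] at hk'
  omega

/-- A square integer submatrix of a totally unimodular family that has even column sums has a
nonzero vector in its left kernel. -/
theorem TotallyUnimodularFamily.exists_vecMul_eq_zero {W ι : Type*} [Fintype ι] [DecidableEq ι]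
    [Nonempty ι] {D : Set (W → ℤ)} (hD : TotallyUnimodularFamily D) (w : ι → W)
    (d : ι → W → ℤ) (hd : ∀ i, d i ∈ D) (heven : ∀ i, Even (∑ t, d i (w t))) :
    ∃ y : ι → ℤ, y ≠ 0 ∧ ∀ i, ∑ t, y t * d i (w t) = 0 := by
  let A : Matrix ι ι ℤ := Matrix.of fun t i => d i (w t)
  have hdet : A.det ∈ Set.range SignType.cast :=
    (Matrix.isTotallyUnimodular_iff_fintype _).1 hD ι w fun i => ⟨d i, hd i⟩
  have hmod : (A.det : ZMod 2) = 0 := by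
    rw [Int.cast_det, ← Matrix.exists_vecMul_eq_zero_iff]
    refine ⟨1, one_ne_zero, funext fun i => ?_⟩
    have h := (ZMod.intCast_eq_zero_iff_even).2 (heven i)
    simpa [Matrix.vecMul, dotProduct, A] using h
  have hzero : A.det = 0 := by
    rw [ZMod.intCast_eq_zero_iff_even] at hmod
    obtain ⟨s, hs⟩ := hdet
    rw [← hs] at hmod ⊢
    cases s <;> simp_all
  obtain ⟨y, hy, hyA⟩ := Matrix.exists_vecMul_eq_zero_iff.2 hzero
  exact ⟨y, hy, fun i => congrFun hyA i⟩

theorem inr_mem_insert_inl_image_inr {F W : Type*} [DecidableEq F] [DecidableEq W] (f : F)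
    (S : Finset W) (x : W) :
    (Sum.inr x : F ⊕ W) ∈ insert (Sum.inl f) (S.image Sum.inr) ↔ x ∈ S := by simp

theorem inl_mem_insert_inl_image_inr {F W : Type*} [DecidableEq F] [DecidableEq W] (f g : F)
    (S : Finset W) :
    (Sum.inl g : F ⊕ W) ∈ insert (Sum.inl f) (S.image Sum.inr) ↔ g = f := by simp

/-- Every worker on the cycle yields a vector of the demand type which, among the workers of the
cycle, is supported on that worker and the next one. The two entries agree if the next worker is
the next vertex of the cycle, and are opposite if a firm lies in between. -/
theorem DMarket.exists_mem_demandType_of_cycle {F W : Type*} [Fintype W] [DecidableEq F]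
    [DecidableEq W] (M : DMarket F W) {k : ℕ} {j : ZMod k → F ⊕ W}
    {E : ZMod k → Finset (F ⊕ W)} (hE : IsNontrivialOddCycle M.fwEdges k j E)
    (hCh : M.ChPropCycle E) (w : {t // (j t).isRight} → W)
    (hw : ∀ t : {t // (j t).isRight}, j t = Sum.inr (w t))
    (i : {t // (j t).isRight}) :
    ∃ d ∈ M.demandType, ∃ (q : {t // (j t).isRight}) (a b : ℤ),
      (∀ t, d (w t) = (if t = i then a else 0) + if t = q then b else 0) ∧
      ((q.1 = i.1 + 1 ∧ a = 1 ∧ b = 1) ∨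
        (¬ (j (i.1 + 1)).isRight ∧ q.1 = i.1 + 1 + 1 ∧ (a = 1 ∨ a = -1) ∧ b = -a)) := by
  obtain ⟨⟨hk2, hj, hEinj, hedge, hmem⟩, hodd, honly⟩ := hE
  choose f S hS hES using hedge
  have hone : (1 : ZMod k) ≠ 0 := by
    have : Fact (1 < k) := ⟨hk2⟩
    exact one_ne_zero
  have htwo : (1 + 1 : ZMod k) ≠ 0 := by
    intro h
    have h2 : ((2 : ℕ) : ZMod k) = 0 := by push_cast; rw [← h]; norm_num
    have := Nat.le_of_dvd two_pos ((ZMod.natCast_eq_zero_iff 2 k).1 h2)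
    obtain rfl : k = 2 := by omega
    exact absurd hodd (by decide)
  have hwS : ∀ (t : {t // (j t).isRight}) (l : ZMod k), w t ∈ S l ↔ t.1 = l ∨ t.1 = l + 1 := by
    intro t l
    rw [← inr_mem_insert_inl_image_inr (f l), ← hES, ← hw]
    refine ⟨honly l t, ?_⟩
    rintro (h | h) <;> rw [h]
    exacts [(hmem l).1, (hmem l).2]
  have hfirm : ∀ l g, (j l = Sum.inl g ∨ j (l + 1) = Sum.inl g) → f l = g := by
    rintro l g (h | h)
    · have := (hmem l).1
      rw [h, hES, inl_mem_insert_inl_image_inr] at this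
      exact this.symm
    · have := (hmem l).2
      rw [h, hES, inl_mem_insert_inl_image_inr] at this
      exact this.symm
  by_cases hnext : (j (i.1 + 1)).isRight
  · refine ⟨_, M.indicatorVec_mem_demandType (hS i), ⟨i.1 + 1, hnext⟩, 1, 1, fun t => ?_,
      Or.inl ⟨rfl, rfl, rfl⟩⟩
    have : ¬ (t = i ∧ t.1 = i.1 + 1) := by rintro ⟨rfl, h⟩; simp [hone] at h
    simp only [indicatorVec_apply, hwS, Subtype.ext_iff] at this ⊢
    split_ifs <;> tauto
  · obtain ⟨g, hg⟩ : ∃ g, j (i.1 + 1) = Sum.inl g := by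
      cases h : j (i.1 + 1) with
      | inl g => exact ⟨g, rfl⟩
      | inr x => simp [h] at hnext
    have hf₁ := hfirm i g (Or.inr hg)
    have hf₂ := hfirm (i + 1) g (Or.inl hg)
    have hq : (j (i.1 + 1 + 1)).isRight := by
      cases h : j (i.1 + 1 + 1) with
      | inl g' =>
        have hf₃ := hfirm (i + 1) g' (Or.inr h)
        have := hj (h.trans (by rw [hg, ← hf₂, hf₃]))
        simp [hone] at this
      | inr x => rfl
    have hcol : ∀ t, indicatorVec (S i) (w t) = if t = i then 1 else 0 := by
      intro t
      have : t.1 ≠ i.1 + 1 := fun h => hnext (h ▸ t.2)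
      simp only [indicatorVec_apply, hwS, Subtype.ext_iff, this, or_false]
    have hcol' : ∀ t, indicatorVec (S (i + 1)) (w t) =
        if t = ⟨i.1 + 1 + 1, hq⟩ then 1 else 0 := by
      intro t
      have : t.1 ≠ i.1 + 1 := fun h => hnext (h ▸ t.2)
      simp only [indicatorVec_apply, hwS, Subtype.ext_iff, this, false_or]
    have hne : S i ≠ S (i + 1) := fun h => by
      have := hEinj ((hES i).trans (by rw [h, hf₁, ← hf₂, ← hES]))
      simp [hone] at this
    rcases hCh g (S i) (S (i + 1)) ⟨i, by rw [hES, hf₁]⟩ ⟨i + 1, by rw [hES, hf₂]⟩ with h | h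
    · refine ⟨_, M.indicatorVec_sub_mem_demandType (hf₂ ▸ (hS _).2) hne h,
        ⟨i.1 + 1 + 1, hq⟩, 1, -1, fun t => ?_, Or.inr ⟨hnext, rfl, Or.inl rfl, rfl⟩⟩
      rw [Pi.sub_apply, hcol, hcol']
      split_ifs <;> rfl
    · refine ⟨_, M.indicatorVec_sub_mem_demandType (hf₁ ▸ (hS _).2) hne.symm
        (by rwa [Finset.union_comm]),
        ⟨i.1 + 1 + 1, hq⟩, -1, 1, fun t => ?_, Or.inr ⟨hnext, rfl, Or.inr rfl, rfl⟩⟩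
      rw [Pi.sub_apply, hcol, hcol']
      split_ifs <;> rfl

/-- If the firms' demand type `𝒟` is totally unimodular, then the
firm-worker hypergraph contains no nontrivial odd-length cycle with the property that,
for each firm `f` and each pair `S, S'` such that both `{f} ∪ S` and `{f} ∪ S'` are edges
of the cycle, `S = Ch f (S ∪ S')` or `S' = Ch f (S ∪ S')`. -/
theorem stmt4 {F W : Type*} [Fintype F] [Fintype W] [DecidableEq F] [DecidableEq W]
    (M : DMarket F W)
    (hTU : TotallyUnimodularFamily M.demandType) :
    ¬ ∃ (k : ℕ) (j : ZMod k → F ⊕ W) (E : ZMod k → Finset (F ⊕ W)),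
      IsNontrivialOddCycle M.fwEdges k j E ∧ M.ChPropCycle E := by
  rintro ⟨k, j, E, hE, hCh⟩
  have : NeZero k := ⟨by have := hE.1.1; omega⟩
  have hw : ∀ t : {t // (j t).isRight}, ∃ x, j t = Sum.inr x := fun t => Sum.isRight_iff.1 t.2
  choose w hw using hw
  choose d hd q a b hdw hab using M.exists_mem_demandType_of_cycle hE hCh w hw
  have hsum : ∀ (y : {t // (j t).isRight} → ℤ) (i), ∑ t, y t * d i (w t) =
      y i * a i + y (q i) * b i := by
    intro y i
    simp [hdw, mul_add, Finset.sum_add_distrib]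
  have hnextWorker : ∀ i, ¬ (j i).isRight → (j (i + 1)).isRight := by
    intro i hi
    obtain ⟨f, S, -, hS⟩ := hE.1.2.2.2.1 i
    obtain ⟨h₁, h₂⟩ := hE.1.2.2.2.2 i
    have : Fact (1 < k) := ⟨hE.1.1⟩
    have hne : j (i + 1) ≠ j i := fun h => by simpa using hE.1.2.1 h
    rw [hS] at h₁ h₂
    cases h : j i <;> cases h' : j (i + 1) <;> simp_all
  have : Nonempty {t // (j t).isRight} := by
    by_cases h : (j 0).isRight
    exacts [⟨⟨0, h⟩⟩, ⟨⟨0 + 1, hnextWorker 0 h⟩⟩]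
  obtain ⟨y, hy, hyd⟩ := hTU.exists_vecMul_eq_zero w d hd fun i => by
    have h := hsum 1 i
    simp only [Pi.one_apply, one_mul] at h
    rw [h]
    rcases hab i with ⟨-, ha, hb⟩ | ⟨-, -, -, hb⟩ <;> rw [hb]
    · rw [ha]; decide
    · simp
  have hstep : ∀ i, (q i).1 = i.1 + 1 ∧ y (q i) = -y i ∨
      ¬ (j (i.1 + 1)).isRight ∧ (q i).1 = i.1 + 1 + 1 ∧ y (q i) = y i := by
    intro i
    have h := hyd i
    rw [hsum] at h
    rcases hab i with ⟨hq, ha, hb⟩ | ⟨hn, hq, ha | ha, hb⟩ <;> rw [hb, ha] at h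
    · exact Or.inl ⟨hq, by linarith⟩
    · exact Or.inr ⟨hn, hq, by linarith⟩
    · exact Or.inr ⟨hn, hq, by linarith⟩
  let y' : ZMod k → ℤ := fun t => if h : (j t).isRight then y ⟨t, h⟩ else 0
  have hy' : ∀ i : {t // (j t).isRight}, y' i.1 = y i := fun i => dif_pos i.2
  let z : ZMod k → ℤ := fun t => if (j t).isRight then y' t else -y' (t - 1)
  refine hy (funext fun i => ?_)
  have hz := eq_zero_of_forall_add_one_eq_neg hE.2.1 z (fun t => ?_) i
  · simpa [z, i.2, hy'] using hz
  by_cases ht : (j t).isRight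
  · rcases hstep ⟨t, ht⟩ with ⟨hq, hyq⟩ | ⟨hn, -, -⟩
    · have hq' := (q ⟨t, ht⟩).2
      rw [← hy', ← hy', hq] at hyq
      rw [hq] at hq'
      simpa [z, ht, hq'] using hyq
    · simp [z, ht, hn]
  · have hprev : (j (t - 1)).isRight := by
      by_contra h
      exact ht (by simpa using hnextWorker _ h)
    have ht' := hnextWorker t ht
    rcases hstep ⟨t - 1, hprev⟩ with ⟨hq, -⟩ | ⟨-, hq, hyq⟩
    · have hq' := (q ⟨t - 1, hprev⟩).2
      rw [hq] at hq'
      simp [ht] at hq'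
    · rw [← hy', ← hy', hq] at hyq
      simpa [z, ht, ht'] using hyq
end

section
/- Let a matching market with transferable utilities be given. Let ℰ = {{f} ∪ S : f ∈ F, S ∈ 𝒜_f, and f ∈ A_w for every w ∈ S} be the set of potential blocking coalitions, ℐ = {{i} : i ∈ F ∪ W} the collection of singleton coalitions, and for S ∈ ℐ ∪ ℰ let V(S) = v_f(S′) + Σ_{w∈S′} v_w(f) if S = {f} ∪ S′ ∈ ℰ and V(S) = 0 if S ∈ ℐ. Let Ψ be the set of assignments μ with μ(f) ∈ 𝒜_f ∪ {∅} for each f ∈ F and μ(w) ∈ A_w ∪ {ø} for each w ∈ W, and let V̄ = max_{μ∈Ψ} Σ_{f∈F} V({f} ∪ μ(f)) (where V({f} ∪ ∅) = 0). Then a stable matching exists if and only if the optimal value of the linear program: minimize Σ_{i∈F∪W} x(i) over x ∈ ℝ^{F∪W} subject to Σ_{i∈S} x(i) ≥ V(S) for all S ∈ ℐ ∪ ℰ, equals V̄. -/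
open Finset


/-- A many-to-one matching market with transferable utilities: firms `F`, workers `W`,
for each firm `f` a collection `acc f` of (nonempty) acceptable sets of workers and a
valuation `vF f` with `vF f ∅ = 0`, and for each worker `w` a set `accW w` of acceptable
firms and a valuation `vW w` (with `none` denoting being unmatched) with `vW w none = 0`. -/
structure TUMarket (F W : Type*) [Fintype W] [DecidableEq F] [DecidableEq W] where
  acc : F → Finset (Finset W)
  acc_nonempty : ∀ f, ∀ S ∈ acc f, S.Nonempty
  vF : F → Finset W → ℝ
  vF_empty : ∀ f, vF f ∅ = 0
  accW : W → Finset F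
  vW : W → Option F → ℝ
  vW_none : ∀ w, vW w none = 0

namespace TUMarket

variable {F W : Type*} [Fintype W] [DecidableEq F] [DecidableEq W]

/-- Firm `f`'s utility from hiring the set `S` at prices `p`. -/
def Uf (M : TUMarket F W) (f : F) (S : Finset W) (p : W → ℝ) : ℝ :=
  M.vF f S - ∑ w ∈ S, p w

/-- Worker `w`'s utility from being matched to `o` at prices `p`. -/
def Uw (M : TUMarket F W) (w : W) (o : Option F) (p : W → ℝ) : ℝ :=
  M.vW w o + p w

/-- `(μ, p)` is a matching: unmatched workers have price `0`. -/
def IsMatching (_M : TUMarket F W) (μ : W → Option F) (p : W → ℝ) : Prop :=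
  ∀ w, μ w = none → p w = 0

/-- Individual rationality of the matching `(μ, p)`. -/
def IndivRat (M : TUMarket F W) (μ : W → Option F) (p : W → ℝ) : Prop :=
  (∀ w, (∀ f, μ w = some f → f ∈ M.accW w) ∧ 0 ≤ M.Uw w (μ w) p) ∧
  (∀ f, (assignedSet μ f = ∅ ∨ assignedSet μ f ∈ M.acc f) ∧
    0 ≤ M.Uf f (assignedSet μ f) p)

/-- `(f, S, p')` blocks the matching `(μ, p)`: `S` is acceptable to `f`, `f` is acceptable
to every `w ∈ S`, all members of `{f} ∪ S` are weakly better off, and at least one is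
strictly better off. -/
def Blocks (M : TUMarket F W) (μ : W → Option F) (p : W → ℝ)
    (f : F) (S : Finset W) (p' : W → ℝ) : Prop :=
  S ∈ M.acc f ∧ (∀ w ∈ S, f ∈ M.accW w) ∧
    M.Uf f (assignedSet μ f) p ≤ M.Uf f S p' ∧
    (∀ w ∈ S, M.Uw w (μ w) p ≤ M.Uw w (some f) p') ∧
    (M.Uf f (assignedSet μ f) p < M.Uf f S p' ∨
      ∃ w ∈ S, M.Uw w (μ w) p < M.Uw w (some f) p')

/-- Stability of a matching `(μ, p)` in a market with transferable utilities. -/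
def Stable (M : TUMarket F W) (μ : W → Option F) (p : W → ℝ) : Prop :=
  M.IsMatching μ p ∧ M.IndivRat μ p ∧ ¬ ∃ f S p', M.Blocks μ p f S p'

/-- The firm-worker hypergraph of the market: vertices `F ⊕ W`, and an edge
`{f} ∪ S` for each firm `f` and each acceptable set `S ∈ acc f`. -/
def fwEdges (M : TUMarket F W) (e : Finset (F ⊕ W)) : Prop :=
  ∃ f S, S ∈ M.acc f ∧ e = insert (Sum.inl f) (S.image Sum.inr)

end TUMarket

namespace TUMarket

variable {F W : Type*} [Fintype W] [DecidableEq F] [DecidableEq W]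

/-- `μ ∈ Ψ`: an assignment in which no firm gets an unacceptable nonempty set and no
worker gets an unacceptable firm. -/
def InPsi (M : TUMarket F W) (μ : W → Option F) : Prop :=
  (∀ w f, μ w = some f → f ∈ M.accW w) ∧
  (∀ f, assignedSet μ f = ∅ ∨ assignedSet μ f ∈ M.acc f)

/-- The aggregate value `V({f} ∪ S)` obtained by the coalition of firm `f` and worker
set `S` (with `V({f} ∪ ∅) = 0`). -/
def aggVal (M : TUMarket F W) (f : F) (S : Finset W) : ℝ :=
  if S = ∅ then 0 else M.vF f S + ∑ w ∈ S, M.vW w (some f)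

/-- Feasibility for the linear program: `x(i) ≥ V({i}) = 0` for every singleton coalition,
and `x(f) + Σ_{w ∈ S} x(w) ≥ V({f} ∪ S)` for every potential blocking coalition
`{f} ∪ S ∈ ℰ` (that is, `S ∈ 𝒜_f` and `f ∈ A_w` for all `w ∈ S`). -/
def LPFeasible (M : TUMarket F W) (x : F ⊕ W → ℝ) : Prop :=
  (∀ i, 0 ≤ x i) ∧
  ∀ f S, S ∈ M.acc f → (∀ w ∈ S, f ∈ M.accW w) →
    M.vF f S + ∑ w ∈ S, M.vW w (some f) ≤ x (Sum.inl f) + ∑ w ∈ S, x (Sum.inr w)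

end TUMarket

theorem sum_eq_sum_assignedSet_add_sum_unmatched {F W : Type*} [Fintype F] [Fintype W]
    [DecidableEq F] (μ : W → Option F) (g : W → ℝ) :
    ∑ w, g w = ∑ f, ∑ w ∈ assignedSet μ f, g w + ∑ w with μ w = none, g w := by
  rw [← Finset.sum_fiberwise Finset.univ μ g, Fintype.sum_option, add_comm]
  rfl

theorem sum_eq_of_assignment {F W : Type*} [Fintype F] [Fintype W] [DecidableEq F]
    (μ : W → Option F) (x : F ⊕ W → ℝ) :
    ∑ i, x i = ∑ f, (x (Sum.inl f) + ∑ w ∈ assignedSet μ f, x (Sum.inr w)) +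
      ∑ w with μ w = none, x (Sum.inr w) := by
  rw [Fintype.sum_sum_type, sum_eq_sum_assignedSet_add_sum_unmatched μ fun w => x (Sum.inr w),
    Finset.sum_add_distrib, add_assoc]

namespace TUMarket

variable {F W : Type*} [Fintype W] [DecidableEq F] [DecidableEq W]

theorem aggVal_eq (M : TUMarket F W) (f : F) (S : Finset W) :
    M.aggVal f S = M.vF f S + ∑ w ∈ S, M.vW w (some f) := by
  unfold aggVal
  split_ifs with h
  · simp [h, M.vF_empty]
  · rfl

theorem aggVal_assignedSet_le (M : TUMarket F W) {x : F ⊕ W → ℝ} (hx : M.LPFeasible x)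
    {μ : W → Option F} (hμ : M.InPsi μ) (f : F) :
    M.aggVal f (assignedSet μ f) ≤ x (Sum.inl f) + ∑ w ∈ assignedSet μ f, x (Sum.inr w) := by
  rcases hμ.2 f with h | h
  · simpa [aggVal, h] using hx.1 (Sum.inl f)
  · rw [aggVal_eq]
    exact hx.2 f _ h fun w hw => hμ.1 w f (by simpa [assignedSet] using hw)

/-- Weak duality: an assignment's value is at most the objective at any feasible point. -/
theorem sum_aggVal_le [Fintype F] (M : TUMarket F W) {x : F ⊕ W → ℝ} (hx : M.LPFeasible x)
    {μ : W → Option F} (hμ : M.InPsi μ) :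
    ∑ f, M.aggVal f (assignedSet μ f) ≤ ∑ i, x i := by
  rw [sum_eq_of_assignment μ x]
  have h₁ := Finset.sum_le_sum fun f (_ : f ∈ Finset.univ) => M.aggVal_assignedSet_le hx hμ f
  have h₂ : 0 ≤ ∑ w with μ w = none, x (Sum.inr w) := Finset.sum_nonneg fun w _ => hx.1 _
  linarith

theorem exists_lpFeasible [Finite F] (M : TUMarket F W) : ∃ x, M.LPFeasible x := by
  cases nonempty_fintype F
  obtain ⟨C, hC⟩ := (Set.finite_range fun q : F × Finset W =>
    M.vF q.1 q.2 + ∑ w ∈ q.2, M.vW w (some q.1)).bddAbove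
  refine ⟨fun _ => max C 0, fun _ => le_max_right _ _, fun f S _ _ => ?_⟩
  have h₁ : M.vF f S + ∑ w ∈ S, M.vW w (some f) ≤ C := hC ⟨(f, S), rfl⟩
  have h₂ : 0 ≤ ∑ _w ∈ S, max C 0 := Finset.sum_nonneg fun _ _ => le_max_right _ _
  linarith [le_max_left C 0]

theorem isClosed_lpFeasible (M : TUMarket F W) : IsClosed {x | M.LPFeasible x} := by
  simp only [LPFeasible, Set.ofPred_and, Set.ofPred_forall]
  refine IsClosed.inter ?_ ?_
  · exact isClosed_iInter fun i => isClosed_le continuous_const (continuous_apply i)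
  · exact isClosed_iInter fun f => isClosed_iInter fun S => isClosed_iInter fun _ =>
      isClosed_iInter fun _ => isClosed_le continuous_const (by fun_prop)

/-- The linear program attains its optimal value. -/
theorem exists_isLeast_lp [Fintype F] (M : TUMarket F W) :
    ∃ x, M.LPFeasible x ∧ ∀ y, M.LPFeasible y → ∑ i, x i ≤ ∑ i, y i := by
  obtain ⟨x₀, hx₀⟩ := M.exists_lpFeasible
  have hcont : Continuous fun x : F ⊕ W → ℝ => ∑ i, x i := by fun_prop
  have hcompact : IsCompact ({x | M.LPFeasible x} ∩ {x | ∑ i, x i ≤ ∑ i, x₀ i}) := by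
    refine (isCompact_Icc (a := (0 : F ⊕ W → ℝ)) (b := fun _ => ∑ i, x₀ i)).of_isClosed_subset
      (M.isClosed_lpFeasible.inter (isClosed_le hcont continuous_const)) ?_
    rintro x ⟨hx, hle⟩
    exact ⟨hx.1, fun i =>
      (Finset.single_le_sum (fun j _ => hx.1 j) (Finset.mem_univ i)).trans hle⟩
  obtain ⟨x, hx, hmin⟩ := hcompact.exists_isMinOn ⟨x₀, hx₀, le_refl (∑ i, x₀ i)⟩ hcont.continuousOn
  refine ⟨x, hx.1, fun y hy => ?_⟩
  rcases le_total (∑ i, y i) (∑ i, x₀ i) with h | h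
  · exact hmin ⟨hy, h⟩
  · exact hx.2.trans h

theorem IndivRat.inPsi {M : TUMarket F W} {μ : W → Option F} {p : W → ℝ}
    (h : M.IndivRat μ p) : M.InPsi μ :=
  ⟨fun w => (h.1 w).1, fun f => (h.2 f).1⟩

/-- The utilities of all agents at `(μ, p)`. -/
def payoff (M : TUMarket F W) (μ : W → Option F) (p : W → ℝ) : F ⊕ W → ℝ :=
  Sum.elim (fun f => M.Uf f (assignedSet μ f) p) fun w => M.Uw w (μ w) p

theorem Stable.lpFeasible_payoff {M : TUMarket F W} {μ : W → Option F} {p : W → ℝ}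
    (h : M.Stable μ p) : M.LPFeasible (M.payoff μ p) := by
  obtain ⟨-, hir, hblock⟩ := h
  refine ⟨?_, fun f S hS hacc => ?_⟩
  · rintro (f | w)
    · exact (hir.2 f).2
    · exact (hir.1 w).2
  · by_contra! hlt
    simp only [payoff, Sum.elim_inl, Sum.elim_inr] at hlt
    have hgain : M.Uf f (assignedSet μ f) p <
        M.Uf f S fun w => M.Uw w (μ w) p - M.vW w (some f) := by
      have hU : M.Uf f S (fun w => M.Uw w (μ w) p - M.vW w (some f)) =
          M.vF f S - (∑ w ∈ S, M.Uw w (μ w) p - ∑ w ∈ S, M.vW w (some f)) := by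
        rw [Uf, Finset.sum_sub_distrib]
      linarith
    exact hblock ⟨f, S, _, hS, hacc, hgain.le, fun w _ => by simp [Uw], Or.inl hgain⟩

theorem IsMatching.sum_payoff [Fintype F] {M : TUMarket F W} {μ : W → Option F} {p : W → ℝ}
    (h : M.IsMatching μ p) :
    ∑ i, M.payoff μ p i = ∑ f, M.aggVal f (assignedSet μ f) := by
  rw [sum_eq_of_assignment μ]
  have hun : ∑ w with μ w = none, M.payoff μ p (Sum.inr w) = 0 :=
    Finset.sum_eq_zero fun w hw => by
      have hw : μ w = none := by simpa using hw
      simp [payoff, Uw, hw, M.vW_none, h w hw]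
  rw [hun, add_zero]
  refine Finset.sum_congr rfl fun f _ => ?_
  have hw : ∑ w ∈ assignedSet μ f, M.payoff μ p (Sum.inr w) =
      ∑ w ∈ assignedSet μ f, (M.vW w (some f) + p w) :=
    Finset.sum_congr rfl fun w hw => by
      have hw : μ w = some f := by simpa [assignedSet] using hw
      simp [payoff, Uw, hw]
  rw [hw, aggVal_eq, Finset.sum_add_distrib]
  simp only [payoff, Uf, Sum.elim_inl]
  ring

theorem stable_of_payoff {M : TUMarket F W} {μ : W → Option F} {p : W → ℝ}
    (hm : M.IsMatching μ p) (hμ : M.InPsi μ) (hx : M.LPFeasible (M.payoff μ p)) :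
    M.Stable μ p := by
  refine ⟨hm, ⟨fun w => ⟨hμ.1 w, hx.1 (Sum.inr w)⟩, fun f => ⟨hμ.2 f, hx.1 (Sum.inl f)⟩⟩, ?_⟩
  rintro ⟨f, S, p', hS, hacc, hf, hw, hstrict⟩
  have hfeas := hx.2 f S hS hacc
  simp only [payoff, Sum.elim_inl, Sum.elim_inr] at hfeas
  have hsum := Finset.sum_le_sum hw
  have htotal : M.Uf f S p' + ∑ w ∈ S, M.Uw w (some f) p' =
      M.vF f S + ∑ w ∈ S, M.vW w (some f) := by
    simp only [Uf, Uw, Finset.sum_add_distrib]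
    ring
  rcases hstrict with h | ⟨w, hwS, h⟩
  · linarith
  · have := Finset.sum_lt_sum hw ⟨w, hwS, h⟩
    linarith

/-- Complementary slackness: a feasible point whose objective equals the value of an assignment
is the payoff vector of that assignment at suitable prices. -/
theorem exists_payoff_eq [Fintype F] {M : TUMarket F W} {x : F ⊕ W → ℝ} (hx : M.LPFeasible x)
    {μ : W → Option F} (hμ : M.InPsi μ)
    (heq : ∑ i, x i = ∑ f, M.aggVal f (assignedSet μ f)) :
    ∃ p, M.IsMatching μ p ∧ M.payoff μ p = x := by
  rw [sum_eq_of_assignment μ x] at heq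
  have hle := fun f (_ : f ∈ Finset.univ) => M.aggVal_assignedSet_le hx hμ f
  have hsum := Finset.sum_le_sum hle
  have hnonneg : ∀ w ∈ Finset.univ.filter (fun w => μ w = none), 0 ≤ x (Sum.inr w) :=
    fun w _ => hx.1 _
  have hunsum := Finset.sum_nonneg hnonneg
  have hun : ∀ w, μ w = none → x (Sum.inr w) = 0 := fun w hw =>
    (Finset.sum_eq_zero_iff_of_nonneg hnonneg).1 (by linarith) w (by simpa using hw)
  have hfirm := (Finset.sum_eq_sum_iff_of_le hle).1 (by linarith)
  refine ⟨fun w => x (Sum.inr w) - M.vW w (μ w), fun w hw => ?_, ?_⟩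
  · simp [hw, hun w hw, M.vW_none]
  · ext (f | w)
    · have hf := hfirm f (Finset.mem_univ f)
      rw [aggVal_eq] at hf
      have hv : ∑ w ∈ assignedSet μ f, M.vW w (μ w) =
          ∑ w ∈ assignedSet μ f, M.vW w (some f) :=
        Finset.sum_congr rfl fun w hw => by
          have hw : μ w = some f := by simpa [assignedSet] using hw
          rw [hw]
      simp only [payoff, Uf, Sum.elim_inl, Finset.sum_sub_distrib, hv]
      linarith
    · simp [payoff, Uw]

end TUMarket

/-- Let `V̄` be the maximum of `Σ_f V({f} ∪ μ(f))` over `μ ∈ Ψ`. Then a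
stable matching exists if and only if the optimal value of the linear program
"minimize `Σ_i x(i)` subject to `Σ_{i ∈ S} x(i) ≥ V(S)` for all `S ∈ ℐ ∪ ℰ`" equals `V̄`. -/
theorem stmt7 {F W : Type*} [Fintype F] [Fintype W] [DecidableEq F] [DecidableEq W]
    (M : TUMarket F W) (Vbar : ℝ)
    (hV : IsGreatest {v : ℝ | ∃ μ : W → Option F,
      M.InPsi μ ∧ v = ∑ f, M.aggVal f (assignedSet μ f)} Vbar) :
    (∃ (μ : W → Option F) (p : W → ℝ), M.Stable μ p) ↔
      sInf {s : ℝ | ∃ x : F ⊕ W → ℝ, M.LPFeasible x ∧ s = ∑ i, x i} = Vbar := by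
  obtain ⟨x, hx, hmin⟩ := M.exists_isLeast_lp
  have hinf : sInf {s : ℝ | ∃ x : F ⊕ W → ℝ, M.LPFeasible x ∧ s = ∑ i, x i} = ∑ i, x i :=
    IsLeast.csInf_eq ⟨⟨x, hx, rfl⟩, by rintro _ ⟨y, hy, rfl⟩; exact hmin y hy⟩
  rw [hinf]
  constructor
  · rintro ⟨μ, p, h⟩
    apply le_antisymm
    · exact (hmin _ h.lpFeasible_payoff).trans
        (h.1.sum_payoff.trans_le (hV.2 ⟨μ, h.2.1.inPsi, rfl⟩))
    · obtain ⟨ν, hν, rfl⟩ := hV.1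
      exact M.sum_aggVal_le hx hν
  · intro heq
    obtain ⟨μ, hμ, rfl⟩ := hV.1
    obtain ⟨p, hm, rfl⟩ := TUMarket.exists_payoff_eq hx hμ heq
    exact ⟨μ, p, TUMarket.stable_of_payoff hm hμ hx⟩
end

section
/- Consider the discrete many-to-one matching market with firms F = {f₁, f₂} and workers W = {w₁, w₂}, where f₁'s strict preference over 2^W ranks {w₁, w₂} ≻ ∅ ≻ {w₁} ≻ {w₂}, f₂'s strict preference ranks {w₁} ≻ {w₂} ≻ ∅ ≻ {w₁, w₂}, worker w₁'s preference ranks f₁ ≻ f₂ ≻ ø, and worker w₂'s preference ranks f₂ ≻ f₁ ≻ ø. This market has no stable matching. -/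
open Finset


/-- In an individually rational matching no firm strictly prefers the empty set to its
assigned set. -/
theorem DMarket.IndivRat.not_pf_empty {F W : Type*} [Fintype W] [DecidableEq F] [DecidableEq W]
    {M : DMarket F W} {μ : W → Option F} (h : M.IndivRat μ) (f : F) :
    ¬ M.pf f ∅ (assignedSet μ f) := by
  intro hpf
  have := M.pf_sto f
  have hmax := M.Ch_max f (assignedSet μ f) ∅ (empty_subset _)
  rw [h.2 f] at hmax
  by_cases he : ∅ = assignedSet μ f
  · rw [← he] at hpf
    exact irrefl _ hpf
  · exact asymm hpf (hmax he)

/-- The discrete market with firms `f₁ = 0, f₂ = 1`, workers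
`w₁ = 0, w₂ = 1`, firm preferences `f₁ : {w₁,w₂} ≻ ∅ ≻ {w₁} ≻ {w₂}` and
`f₂ : {w₁} ≻ {w₂} ≻ ∅ ≻ {w₁,w₂}`, and worker preferences `w₁ : f₁ ≻ f₂ ≻ ø` and
`w₂ : f₂ ≻ f₁ ≻ ø`, has no stable matching. -/
theorem stmt11 (M : DMarket (Fin 2) (Fin 2))
    (hf1a : M.pf 0 {0, 1} ∅) (hf1b : M.pf 0 ∅ {0}) (hf1c : M.pf 0 {0} {1})
    (hf2a : M.pf 1 {0} {1}) (hf2b : M.pf 1 {1} ∅) (hf2c : M.pf 1 ∅ {0, 1})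
    (hw1a : M.pw 0 (some 0) (some 1)) (hw1b : M.pw 0 (some 1) none)
    (hw2a : M.pw 1 (some 1) (some 0)) (hw2b : M.pw 1 (some 0) none) :
    ¬ ∃ μ : Fin 2 → Option (Fin 2), M.Stable μ := by
  rintro ⟨μ, hir, hblock⟩
  have := M.pf_sto 0
  have := M.pf_sto 1
  have hf1_one : M.pf 0 ∅ {1} := _root_.trans hf1b hf1c
  have hir1 := hir.not_pf_empty 0
  have hir2 := hir.not_pf_empty 1
  have no_block (f S) (hS : ∀ w ∈ S, μ w = some f ∨ M.pw w (some f) (μ w)) :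
      ¬ M.pf f S (assignedSet μ f) := fun h => hblock ⟨f, S, hS, h⟩
  have assigned (f : Fin 2) (A : Finset (Fin 2))
      (hA0 : μ 0 = some f ↔ 0 ∈ A) (hA1 : μ 1 = some f ↔ 1 ∈ A) : assignedSet μ f = A := by
    ext w
    fin_cases w <;> simpa [assignedSet]
  have option_cases (o : Option (Fin 2)) : o = none ∨ o = some 0 ∨ o = some 1 := by
    revert o
    decide
  rcases option_cases (μ 0) with h0 | h0 | h0 <;> rcases option_cases (μ 1) with h1 | h1 | h1
  · refine no_block 1 {0} (by simp [h0, hw1b]) ?_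
    rw [assigned 1 ∅ (by simp [h0]) (by simp [h1])]
    exact _root_.trans hf2a hf2b
  · rw [assigned 0 {1} (by simp [h0]) (by simp [h1])] at hir1
    exact hir1 hf1_one
  · refine no_block 1 {0} (by simp [h0, hw1b]) ?_
    rwa [assigned 1 {1} (by simp [h0]) (by simp [h1])]
  · rw [assigned 0 {0} (by simp [h0]) (by simp [h1])] at hir1
    exact hir1 hf1b
  · refine no_block 1 {1} (by simp [h1, hw2a]) ?_
    rwa [assigned 1 ∅ (by simp [h0]) (by simp [h1])]
  · rw [assigned 0 {0} (by simp [h0]) (by simp [h1])] at hir1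
    exact hir1 hf1b
  · refine no_block 0 {0, 1} (by simp [h0, h1, hw1a, hw2b]) ?_
    rwa [assigned 0 ∅ (by simp [h0]) (by simp [h1])]
  · rw [assigned 0 {1} (by simp [h0]) (by simp [h1])] at hir1
    exact hir1 hf1_one
  · rw [assigned 1 {0, 1} (by simp [h0]) (by simp [h1])] at hir2
    exact hir2 hf2c
end

section
/- Consider the matching market with transferable utilities with firms F = {f₁, f₂} and workers W = {w₁, w₂}, where 𝒜_{f₁} = {{w₁, w₂}} with v_{f₁}({w₁, w₂}) = 6; 𝒜_{f₂} = {{w₁}, {w₂}} with v_{f₂}({w₁}) = v_{f₂}({w₂}) = 4; and A_{w₁} = A_{w₂} = {f₁, f₂} with v_w(f) = 0 for every worker w and firm f. This market has no stable matching. -/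
open Finset


/-- If all workers have valuation `0`, then at the prices of a stable matching no firm prefers
another acceptable set of workers to the one it is assigned. -/
theorem TUMarket.Stable.uf_le {F W : Type*} [Fintype W] [DecidableEq F] [DecidableEq W]
    {M : TUMarket F W} {μ : W → Option F} {p : W → ℝ} (h : M.Stable μ p)
    (hvW : ∀ w o, M.vW w o = 0) {f : F} {S : Finset W} (hS : S ∈ M.acc f)
    (hf : ∀ w ∈ S, f ∈ M.accW w) :
    M.Uf f S p ≤ M.Uf f (assignedSet μ f) p := by
  by_contra! hlt
  exact h.2.2 ⟨f, S, p, hS, hf, hlt.le, fun w _ => by simp [TUMarket.Uw, hvW], Or.inl hlt⟩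

/-- The market with transferable utilities with firms `f₁ = 0, f₂ = 1`,
workers `w₁ = 0, w₂ = 1`, `𝒜_{f₁} = {{w₁,w₂}}` with value `6`, `𝒜_{f₂} = {{w₁},{w₂}}`
with values `4`, all firms acceptable to all workers, and all workers' valuations `0`,
has no stable matching. -/
theorem stmt12 (M : TUMarket (Fin 2) (Fin 2))
    (hacc1 : M.acc 0 = {{0, 1}}) (hv1 : M.vF 0 {0, 1} = 6)
    (hacc2 : M.acc 1 = {{0}, {1}}) (hv2a : M.vF 1 {0} = 4) (hv2b : M.vF 1 {1} = 4)
    (haccW : ∀ w, M.accW w = Finset.univ)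
    (hvW : ∀ w o, M.vW w o = 0) :
    ¬ ∃ (μ : Fin 2 → Option (Fin 2)) (p : Fin 2 → ℝ), M.Stable μ p := by
  rintro ⟨μ, p, h⟩
  have key₁ := h.uf_le hvW (f := 0) (S := {0, 1}) (by simp [hacc1]) (by simp [haccW])
  have key₂ := h.uf_le hvW (f := 1) (S := {0}) (by simp [hacc2]) (by simp [haccW])
  have key₃ := h.uf_le hvW (f := 1) (S := {1}) (by simp [hacc2]) (by simp [haccW])
  obtain ⟨hmatch, ⟨hW, hF⟩, -⟩ := h
  have hp₀ := (hW 0).2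
  have hp₁ := (hW 1).2
  have hm₀ := hmatch 0
  have hm₁ := hmatch 1
  obtain ⟨hacc₁, hu₁⟩ := hF 0
  obtain ⟨hacc₂, hu₂⟩ := hF 1
  clear hF hW hmatch
  obtain ⟨a, b, rfl⟩ : ∃ a b, μ = ![a, b] := ⟨μ 0, μ 1, by ext i : 1; fin_cases i <;> rfl⟩
  have hset (f : Fin 2) : assignedSet ![a, b] f =
      (if a = some f then {0} else ∅) ∪ (if b = some f then {1} else ∅) := by
    ext i
    fin_cases i <;> simp [assignedSet] <;> split_ifs <;> simp_all
  have hsum : ∑ w ∈ ({0, 1} : Finset (Fin 2)), p w = p 0 + p 1 := Fin.sum_univ_two p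
  simp only [hset, hacc1, hacc2, Finset.mem_insert, Finset.mem_singleton] at *
  have hcases : ∀ o : Option (Fin 2), o = none ∨ o = some 0 ∨ o = some 1 := by decide
  rcases hcases a with rfl | rfl | rfl <;> rcases hcases b with rfl | rfl | rfl <;>
    simp [TUMarket.Uf, TUMarket.Uw, hvW, M.vF_empty, hv2a, hv2b] at * <;>
    first
    | linarith
    | exact absurd hacc₁ (by decide)
    | exact absurd hacc₂ (by decide)
end

section
/- Let H* be the hypergraph with vertex set {f₁, f₂, f₃, w₁, w₂, w₃, w₄} and edge set {{f₁, w₁, w₂, w₄}, {f₂, w₂, w₃, w₄}, {f₃, w₁, w₃, w₄}}. Then H* contains a nontrivial odd-length cycle, yet every matching market with transferable utilities whose firm-worker hypergraph equals H* (i.e., F = {f₁, f₂, f₃}, W = {w₁, w₂, w₃, w₄}, 𝒜_{f₁} = {{w₁, w₂, w₄}}, 𝒜_{f₂} = {{w₂, w₃, w₄}}, 𝒜_{f₃} = {{w₁, w₃, w₄}}, with arbitrary valuations and arbitrary acceptable-firm sets and valuations for workers) has a stable matching. -/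
open Finset


/-- The hypergraph `H*` with vertices `f₁, f₂, f₃` (as `Sum.inl 0, 1, 2`) and
`w₁, w₂, w₃, w₄` (as `Sum.inr 0, 1, 2, 3`) and edges `{f₁, w₁, w₂, w₄}`,
`{f₂, w₂, w₃, w₄}`, `{f₃, w₁, w₃, w₄}`. -/
def edgesHstar (e : Finset (Fin 3 ⊕ Fin 4)) : Prop :=
  e = {Sum.inl 0, Sum.inr 0, Sum.inr 1, Sum.inr 3} ∨
  e = {Sum.inl 1, Sum.inr 1, Sum.inr 2, Sum.inr 3} ∨
  e = {Sum.inl 2, Sum.inr 0, Sum.inr 2, Sum.inr 3}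

namespace TUMarket

variable {F W : Type*} [Fintype W] [DecidableEq F] [DecidableEq W]

/-- The total surplus generated when firm `f` hires the set `S`. -/
def surplus (M : TUMarket F W) (f : F) (S : Finset W) : ℝ :=
  M.vF f S + ∑ w ∈ S, M.vW w (some f)

/-- If every acceptable set contains the worker `w₀`, and `w₀` already receives at least the
surplus of every feasible coalition, then an individually rational matching is stable. -/
theorem stable_of_surplus_le (M : TUMarket F W) {w₀ : W}
    (hw₀ : ∀ f, ∀ S ∈ M.acc f, w₀ ∈ S) {μ : W → Option F} {p : W → ℝ}
    (hm : M.IsMatching μ p) (hir : M.IndivRat μ p)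
    (hle : ∀ f, ∀ S ∈ M.acc f, (∀ w ∈ S, f ∈ M.accW w) →
      M.surplus f S ≤ M.Uw w₀ (μ w₀) p) :
    M.Stable μ p := by
  refine ⟨hm, hir, ?_⟩
  rintro ⟨f, S, p', hS, hacc, hF, hW, hlt⟩
  have hF0 := (hir.2 f).2
  have hsum : M.surplus f S = M.Uf f S p' + ∑ w ∈ S, M.Uw w (some f) p' := by
    simp only [surplus, Uf, Uw, Finset.sum_add_distrib]
    ring
  have hsingle : M.Uw w₀ (μ w₀) p ≤ ∑ w ∈ S, M.Uw w (μ w) p :=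
    Finset.single_le_sum (f := fun w => M.Uw w (μ w) p) (fun w _ => (hir.1 w).2) (hw₀ f S hS)
  have hmax := hle f S hS hacc
  have hWsum := Finset.sum_le_sum hW
  rcases hlt with hlt | ⟨w, hw, hlt⟩
  · linarith
  · have := Finset.sum_lt_sum hW ⟨w, hw, hlt⟩
    linarith

/-- A market in which all acceptable sets share a common worker has a stable matching. -/
theorem exists_stable_of_common_worker [Finite F] (M : TUMarket F W) (w₀ : W)
    (hw₀ : ∀ f, ∀ S ∈ M.acc f, w₀ ∈ S) :
    ∃ (μ : W → Option F) (p : W → ℝ), M.Stable μ p := by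
  by_cases hpos : ∃ f, ∃ S ∈ M.acc f, (∀ w ∈ S, f ∈ M.accW w) ∧ 0 < M.surplus f S
  · let C : Set (F × Finset W) := {c | c.2 ∈ M.acc c.1 ∧ ∀ w ∈ c.2, c.1 ∈ M.accW w}
    obtain ⟨f₁, S₁, hS₁, hacc₁, hpos₁⟩ := hpos
    obtain ⟨⟨f, S⟩, ⟨hS, hacc⟩, hmax⟩ :=
      Set.exists_max_image C (fun c => M.surplus c.1 c.2) C.toFinite ⟨(f₁, S₁), hS₁, hacc₁⟩
    dsimp only at hS hacc hmax
    have hV : 0 < M.surplus f S := hpos₁.trans_le (hmax (f₁, S₁) ⟨hS₁, hacc₁⟩)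
    have hmem := hw₀ f S hS
    let μ : W → Option F := fun w => if w ∈ S then some f else none
    let p : W → ℝ := fun w =>
      if w ∈ S then (if w = w₀ then M.surplus f S else 0) - M.vW w (some f) else 0
    have hU : ∀ w, M.Uw w (μ w) p = if w = w₀ then M.surplus f S else 0 := by
      intro w
      by_cases hw : w ∈ S
      · simp [Uw, μ, p, hw]
      · have hne : w ≠ w₀ := fun h => hw (h ▸ hmem)
        simp [Uw, μ, p, hw, hne, M.vW_none]
    have hset : assignedSet μ f = S := by
      ext w
      simp [assignedSet, μ]
    have hset' : ∀ g, g ≠ f → assignedSet μ g = ∅ := by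
      intro g hg
      ext w
      simp [assignedSet, μ, hg.symm]
    have hUf : M.Uf f S p = 0 := by
      have hp : ∑ w ∈ S, p w =
          ∑ w ∈ S, ((if w = w₀ then M.surplus f S else 0) - M.vW w (some f)) :=
        Finset.sum_congr rfl fun w hw => if_pos hw
      rw [Uf, hp, Finset.sum_sub_distrib, Finset.sum_ite_eq' S w₀, if_pos hmem, surplus]
      ring
    refine ⟨μ, p, M.stable_of_surplus_le hw₀ ?_ ⟨?_, ?_⟩ ?_⟩
    · intro w hw
      by_cases h : w ∈ S
      · simp [μ, h] at hw
      · simp [p, h]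
    · refine fun w => ⟨fun g hg => ?_, ?_⟩
      · by_cases h : w ∈ S
        · obtain rfl : f = g := by simpa [μ, h] using hg
          exact hacc w h
        · simp [μ, h] at hg
      · rw [hU]
        split_ifs
        exacts [hV.le, le_rfl]
    · intro g
      by_cases hg : g = f
      · subst hg
        rw [hset]
        exact ⟨Or.inr hS, hUf.ge⟩
      · rw [hset' g hg]
        exact ⟨Or.inl rfl, by simp [Uf, M.vF_empty]⟩
    · intro g T hT hTacc
      rw [hU, if_pos rfl]
      exact hmax (g, T) ⟨hT, hTacc⟩
  · push Not at hpos
    refine ⟨fun _ => none, fun _ => 0, M.stable_of_surplus_le hw₀ (fun _ _ => rfl) ⟨?_, ?_⟩ ?_⟩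
    · simp [Uw, M.vW_none]
    · simp [assignedSet, Uf, M.vF_empty]
    · simpa [Uw, M.vW_none] using hpos

end TUMarket

/-- The workers `w₁, w₂, w₃` form a nontrivial cycle of length three in `H*`. -/
theorem hasNontrivialOddCycle_edgesHstar : HasNontrivialOddCycle edgesHstar := by
  let j : Fin 3 → Fin 3 ⊕ Fin 4 := ![Sum.inr 0, Sum.inr 1, Sum.inr 2]
  let E : Fin 3 → Finset (Fin 3 ⊕ Fin 4) :=
    ![{Sum.inl 0, Sum.inr 0, Sum.inr 1, Sum.inr 3},
      {Sum.inl 1, Sum.inr 1, Sum.inr 2, Sum.inr 3},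
      {Sum.inl 2, Sum.inr 0, Sum.inr 2, Sum.inr 3}]
  have hj : Function.Injective j := by decide
  have hE : Function.Injective E := by decide
  have hedge : ∀ i, edgesHstar (E i) := by
    unfold edgesHstar
    decide
  have hinc : ∀ i, j i ∈ E i ∧ j (i + 1) ∈ E i := by decide
  have honly : ∀ i t : Fin 3, j t ∈ E i → t = i ∨ t = i + 1 := by decide
  exact ⟨3, j, E, ⟨by norm_num, hj, hE, hedge, hinc⟩, by decide, honly⟩

/-- `H*` contains a nontrivial odd-length cycle, yet every matching
market with transferable utilities whose firm-worker hypergraph equals `H*` has a stable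
matching. -/
theorem stmt14 :
    HasNontrivialOddCycle edgesHstar ∧
    ∀ M : TUMarket (Fin 3) (Fin 4),
      M.acc 0 = {{0, 1, 3}} → M.acc 1 = {{1, 2, 3}} → M.acc 2 = {{0, 2, 3}} →
      ∃ (μ : Fin 4 → Option (Fin 3)) (p : Fin 4 → ℝ), M.Stable μ p := by
  refine ⟨hasNontrivialOddCycle_edgesHstar, fun M h0 h1 h2 =>
    M.exists_stable_of_common_worker 3 fun f S hS => ?_⟩
  fin_cases f <;> simp_all
end

section
/- Every discrete many-to-one matching market with firms F = {f₁, f₂, f₃} and workers W = {w₁, w₂, w₃, w₄} whose firm-worker hypergraph equals the hypergraph H* with edges {{f₁, w₁, w₂, w₄}, {f₂, w₂, w₃, w₄}, {f₃, w₁, w₃, w₄}} (i.e., the collections of satisfactory sets are 𝒴_{f₁} = {{w₁, w₂, w₄}}, 𝒴_{f₂} = {{w₂, w₃, w₄}}, 𝒴_{f₃} = {{w₁, w₃, w₄}}) has a stable matching, for every profile of workers' strict preferences over F ∪ {ø}. -/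
open Finset


namespace DMarket

variable {F W : Type*} [Fintype W] [DecidableEq F] [DecidableEq W] {M : DMarket F W}

theorem IndivRat.pw_none_of_pw {μ : W → Option F} (hμ : M.IndivRat μ) {w : W} {a : Option F}
    (h : M.pw w a (μ w)) : M.pw w a none := by
  have := M.pw_sto w
  rcases hμ.1 w with h0 | h0
  · rwa [h0] at h
  · exact trans_of (M.pw w) h h0

/-- A coalition blocking an individually rational matching shrinks to a satisfactory one. -/
theorem Blocks.satisf_ch {μ : W → Option F} (hμ : M.IndivRat μ) {f : F} {S : Finset W}
    (h : M.Blocks μ f S) : M.Satisf f (M.Ch f S) ∧ M.Blocks μ f (M.Ch f S) := by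
  have := M.pf_sto f
  have hpf : M.pf f (M.Ch f S) (assignedSet μ f) := by
    by_cases hS : S = M.Ch f S
    · rw [← hS]; exact h.2
    · exact trans_of (M.pf f) (M.Ch_max f S S subset_rfl hS) h.2
  refine ⟨⟨Finset.nonempty_iff_ne_empty.2 fun he => ?_, ?_⟩,
    fun w hw => h.1 w (M.Ch_subset f S hw), hpf⟩
  · rw [he] at hpf
    by_cases h0 : ∅ = assignedSet μ f
    · rw [← h0] at hpf
      exact irrefl_of (M.pf f) _ hpf
    · have := M.Ch_max f (assignedSet μ f) ∅ (Finset.empty_subset _) (by rwa [hμ.2 f])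
      rw [hμ.2 f] at this
      exact asymm_of (M.pf f) hpf this
  · by_contra hne
    have h1 := M.Ch_max f _ _ subset_rfl (Ne.symm hne)
    have h2 := M.Ch_max f S (M.Ch f (M.Ch f S))
      ((M.Ch_subset f _).trans (M.Ch_subset f S)) hne
    exact asymm_of (M.pf f) h1 h2

/-- If every firm has exactly one satisfactory set and these sets have a common worker, then
a stable matching exists: among the firms acceptable to their whole satisfactory set, let the
common worker's favourite hire. -/
theorem exists_stable_of_common_worker [Finite F] (T : F → Finset W)
    (hT : ∀ f S, M.Satisf f S ↔ S = T f) (w₀ : W) (hw₀ : ∀ f, w₀ ∈ T f) :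
    ∃ μ : W → Option F, M.Stable μ := by
  have hCh : ∀ f, M.Ch f (T f) = T f := fun f => ((hT f _).2 rfl).2
  have hCh0 : ∀ f, M.Ch f ∅ = ∅ := fun f => Finset.subset_empty.1 (M.Ch_subset f ∅)
  have hblock : ∀ μ, M.IndivRat μ → ∀ f S, M.Blocks μ f S → M.Blocks μ f (T f) := by
    intro μ hμ f S h
    obtain ⟨hs, hb⟩ := h.satisf_ch hμ
    rwa [(hT f _).1 hs] at hb
  by_cases hA : ∃ f, ∀ w ∈ T f, M.pw w (some f) none
  · have := M.pw_sto w₀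
    obtain ⟨_, ⟨f, hf, rfl⟩, hmax⟩ :=
      (Finite.wellFounded_of_trans_of_irrefl (M.pw w₀)).has_min
        (some '' {f | ∀ w ∈ T f, M.pw w (some f) none}) (Set.Nonempty.image _ hA)
    have hself : assignedSet (fun w => if w ∈ T f then some f else none) f = T f := by
      ext w; simp [assignedSet]
    have hother : ∀ g, g ≠ f →
        assignedSet (fun w => if w ∈ T f then some f else none) g = ∅ := by
      intro g hg
      ext w; simp [assignedSet, hg.symm]
    have hIR : M.IndivRat (fun w => if w ∈ T f then some f else none) := by
      refine ⟨fun w => ?_, fun g => ?_⟩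
      · by_cases hw : w ∈ T f
        · simpa [hw] using hf w hw
        · simp [hw]
      · by_cases hg : g = f
        · rw [hg, hself, hCh]
        · rw [hother g hg, hCh0]
    refine ⟨_, hIR, ?_⟩
    rintro ⟨g, S, h⟩
    have hb := hblock _ hIR g S h
    by_cases hg : g = f
    · subst hg
      have := M.pf_sto g
      have := hb.2
      rw [hself] at this
      exact irrefl_of (M.pf g) _ this
    · have hpw : ∀ w ∈ T g, M.pw w (some g) (if w ∈ T f then some f else none) := by
        intro w hw
        refine (hb.1 w hw).resolve_left ?_
        simp [Ne.symm hg]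
      refine hmax (some g) ⟨g, fun w hw => hIR.pw_none_of_pw (hpw w hw), rfl⟩ ?_
      simpa [hw₀ f] using hpw w₀ (hw₀ g)
  · have hIR : M.IndivRat fun _ => none :=
      ⟨fun w => Or.inl rfl, fun g => by simpa [assignedSet] using hCh0 g⟩
    refine ⟨_, hIR, ?_⟩
    rintro ⟨g, S, h⟩
    exact hA ⟨g, fun w hw => ((hblock _ hIR g S h).1 w hw).resolve_left (by simp)⟩

end DMarket

/-- Every discrete matching market with firms `f₁ = 0, f₂ = 1, f₃ = 2`
and workers `w₁ = 0, …, w₄ = 3` whose collections of satisfactory sets are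
`𝒴_{f₁} = {{w₁,w₂,w₄}}`, `𝒴_{f₂} = {{w₂,w₃,w₄}}`, `𝒴_{f₃} = {{w₁,w₃,w₄}}` has a stable
matching, for every profile of workers' preferences. -/
theorem stmt15 (M : DMarket (Fin 3) (Fin 4))
    (h1 : ∀ S : Finset (Fin 4), M.Satisf 0 S ↔ S = {0, 1, 3})
    (h2 : ∀ S : Finset (Fin 4), M.Satisf 1 S ↔ S = {1, 2, 3})
    (h3 : ∀ S : Finset (Fin 4), M.Satisf 2 S ↔ S = {0, 2, 3}) :
    ∃ μ : Fin 4 → Option (Fin 3), M.Stable μ := by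
  refine DMarket.exists_stable_of_common_worker ![{0, 1, 3}, {1, 2, 3}, {0, 2, 3}] ?_ 3 ?_
  · intro f
    fin_cases f
    · exact h1
    · exact h2
    · exact h3
  · decide
end

section
/- Consider a discrete many-to-one matching market with firms F = {f₁, f₂} and workers W = {w₁, w₂}, where f₁'s strict preference over 2^W ranks {w₁, w₂} ≻ ∅ ≻ {w₁} ≻ {w₂} and f₂'s strict preference ranks {w₁, w₂} ≻ {w₁} ≻ {w₂} ≻ ∅. Then the firm-worker hypergraph of this market contains a nontrivial odd-length cycle, but no nontrivial odd-length cycle of this hypergraph has the property that for each firm f and each pair of sets S, S′ with both {f} ∪ S and {f} ∪ S′ edges of the cycle, either S = Ch_f(S ∪ S′) or S′ = Ch_f(S ∪ S′). -/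
open Finset


namespace DMarket

/-- A subset of `S` that is preferred to every other subset of `S` is the chosen set. -/
theorem ch_eq_of_forall_pf {F W : Type*} [Fintype W] [DecidableEq F] [DecidableEq W]
    (M : DMarket F W) {f : F} {S T : Finset W} (hT : T ⊆ S)
    (h : ∀ S' ⊆ S, S' ≠ T → M.pf f T S') : M.Ch f S = T := by
  by_contra hne
  have := M.pf_sto f
  exact asymm_of (M.pf f) (h _ (M.Ch_subset f S) hne) (M.Ch_max f S T hT (Ne.symm hne))

theorem not_satisf_of_pf_empty {F W : Type*} [Fintype W] [DecidableEq F] [DecidableEq W]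
    (M : DMarket F W) {f : F} {S : Finset W} (h : M.pf f ∅ S) : ¬ M.Satisf f S := by
  rintro ⟨hS, hch⟩
  have := M.pf_sto f
  have hmax := M.Ch_max f S ∅ (empty_subset S) (by rw [hch]; exact hS.ne_empty.symm)
  rw [hch] at hmax
  exact asymm_of (M.pf f) h hmax

end DMarket

theorem finset_fin_two_cases (S : Finset (Fin 2)) :
    S = ∅ ∨ S = {0} ∨ S = {1} ∨ S = {0, 1} := by
  revert S; decide

/-- The four edges of the firm-worker hypergraph of the market in `stmt17`. -/
def marketEdge : Fin 4 → Finset (Fin 2 ⊕ Fin 2)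
  | 0 => {Sum.inl 0, Sum.inr 0, Sum.inr 1}
  | 1 => {Sum.inl 1, Sum.inr 0, Sum.inr 1}
  | 2 => {Sum.inl 1, Sum.inr 0}
  | 3 => {Sum.inl 1, Sum.inr 1}

set_option synthInstance.maxHeartbeats 400000 in
set_option synthInstance.maxSize 4000 in
/-- Every nontrivial cycle of length three on the edges `marketEdge` uses both edges of size two. -/
theorem pair_edges_mem_of_triangle :
    ∀ e₀ e₁ : Fin 4, e₀ ≠ e₁ → ∀ e₂ : Fin 4, e₀ ≠ e₂ → e₁ ≠ e₂ →
    ∀ v₀ : Fin 2 ⊕ Fin 2, v₀ ∈ marketEdge e₀ → v₀ ∈ marketEdge e₂ → v₀ ∉ marketEdge e₁ →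
    ∀ v₁ : Fin 2 ⊕ Fin 2, v₁ ∈ marketEdge e₀ → v₁ ∈ marketEdge e₁ → v₁ ∉ marketEdge e₂ →
    ∀ v₂ : Fin 2 ⊕ Fin 2, v₂ ∈ marketEdge e₁ → v₂ ∈ marketEdge e₂ → v₂ ∉ marketEdge e₀ →
    (e₀ = 2 ∨ e₁ = 2 ∨ e₂ = 2) ∧ (e₀ = 3 ∨ e₁ = 3 ∨ e₂ = 3) := by
  decide +kernel

/-- In the discrete market with firms `f₁ = 0, f₂ = 1` and workers
`w₁ = 0, w₂ = 1`, where `f₁ : {w₁,w₂} ≻ ∅ ≻ {w₁} ≻ {w₂}` and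
`f₂ : {w₁,w₂} ≻ {w₁} ≻ {w₂} ≻ ∅`, the firm-worker hypergraph contains a nontrivial
odd-length cycle, but no nontrivial odd-length cycle of it has the property that for each
firm `f` and pair `S, S'` with both `{f} ∪ S` and `{f} ∪ S'` edges of the cycle, either
`S = Ch f (S ∪ S')` or `S' = Ch f (S ∪ S')`. -/
theorem stmt17 (M : DMarket (Fin 2) (Fin 2))
    (hf1a : M.pf 0 {0, 1} ∅) (hf1b : M.pf 0 ∅ {0}) (hf1c : M.pf 0 {0} {1})
    (hf2a : M.pf 1 {0, 1} {0}) (hf2b : M.pf 1 {0} {1}) (hf2c : M.pf 1 {1} ∅) :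
    HasNontrivialOddCycle M.fwEdges ∧
    ¬ ∃ (k : ℕ) (j : ZMod k → Fin 2 ⊕ Fin 2) (E : ZMod k → Finset (Fin 2 ⊕ Fin 2)),
      IsNontrivialOddCycle M.fwEdges k j E ∧ M.ChPropCycle E := by
  have sto0 := M.pf_sto 0
  have sto1 := M.pf_sto 1
  have trans0 : ∀ {A B C}, M.pf 0 A B → M.pf 0 B C → M.pf 0 A C := trans_of (M.pf 0)
  have trans1 : ∀ {A B C}, M.pf 1 A B → M.pf 1 B C → M.pf 1 A C := trans_of (M.pf 1)
  have ch0 : M.Ch 0 {0, 1} = {0, 1} := M.ch_eq_of_forall_pf subset_rfl fun S' _ hne => by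
    rcases finset_fin_two_cases S' with rfl | rfl | rfl | rfl
    · exact hf1a
    · exact trans0 hf1a hf1b
    · exact trans0 hf1a (trans0 hf1b hf1c)
    · exact absurd rfl hne
  have ch1 : M.Ch 1 {0, 1} = {0, 1} := M.ch_eq_of_forall_pf subset_rfl fun S' _ hne => by
    rcases finset_fin_two_cases S' with rfl | rfl | rfl | rfl
    · exact trans1 hf2a (trans1 hf2b hf2c)
    · exact hf2a
    · exact trans1 hf2a hf2b
    · exact absurd rfl hne
  have ch1_zero : M.Ch 1 {0} = {0} := M.ch_eq_of_forall_pf subset_rfl fun S' hS' hne => by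
    rcases subset_singleton_iff.1 hS' with rfl | rfl
    · exact trans1 hf2b hf2c
    · exact absurd rfl hne
  have ch1_one : M.Ch 1 {1} = {1} := M.ch_eq_of_forall_pf subset_rfl fun S' hS' hne => by
    rcases subset_singleton_iff.1 hS' with rfl | rfl
    · exact hf2c
    · exact absurd rfl hne
  have edges_market : ∀ n, M.fwEdges (marketEdge n) := by
    intro n
    fin_cases n
    · exact ⟨0, {0, 1}, ⟨by decide, ch0⟩, by decide⟩
    · exact ⟨1, {0, 1}, ⟨by decide, ch1⟩, by decide⟩
    · exact ⟨1, {0}, ⟨by decide, ch1_zero⟩, by decide⟩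
    · exact ⟨1, {1}, ⟨by decide, ch1_one⟩, by decide⟩
  have edges_cases : ∀ e, M.fwEdges e → ∃ n, e = marketEdge n := by
    rintro e ⟨f, S, hS, rfl⟩
    fin_cases f <;> rcases finset_fin_two_cases S with rfl | rfl | rfl | rfl
    · exact absurd hS.1 (by decide)
    · exact absurd hS (M.not_satisf_of_pf_empty hf1b)
    · exact absurd hS (M.not_satisf_of_pf_empty (trans0 hf1b hf1c))
    · exact ⟨0, by decide⟩
    · exact absurd hS.1 (by decide)
    · exact ⟨2, by decide⟩
    · exact ⟨3, by decide⟩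
    · exact ⟨1, by decide⟩
  constructor
  · let j : Fin 3 → Fin 2 ⊕ Fin 2 := ![Sum.inr 0, Sum.inr 1, Sum.inl 1]
    let e : Fin 3 → Fin 4 := ![0, 3, 2]
    have hj : Function.Injective j := by decide
    have he : Function.Injective fun i => marketEdge (e i) := by decide
    have hmem : ∀ i, j i ∈ marketEdge (e i) ∧ j (i + 1) ∈ marketEdge (e i) := by decide
    have honly : ∀ i t, j t ∈ marketEdge (e i) → t = i ∨ t = i + 1 := by decide
    exact ⟨3, j, fun i => marketEdge (e i),
      ⟨by decide, hj, he, fun i => edges_market _, hmem⟩, by decide, honly⟩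
  · rintro ⟨k, j, E, ⟨⟨hk, hj, hE, hedge, hmem⟩, hodd, honly⟩, hCh⟩
    have : NeZero k := ⟨by omega⟩
    have hcard := Fintype.card_le_of_injective j hj
    rw [ZMod.card] at hcard
    simp only [Fintype.card_sum, Fintype.card_fin] at hcard
    obtain rfl : k = 3 := by
      obtain ⟨m, rfl⟩ := hodd
      omega
    choose e he using fun i => edges_cases (E i) (hedge i)
    have hne : ∀ a b : ZMod 3, a ≠ b → e a ≠ e b := fun a b hab h =>
      hab (hE (by rw [he, he, h]))
    have hnot : ∀ i t : ZMod 3, t ≠ i → t ≠ i + 1 → j t ∉ marketEdge (e i) :=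
      fun i t h h' hm => (honly i t (he i ▸ hm)).elim h h'
    have hleft : ∀ i, j i ∈ marketEdge (e i) := fun i => he i ▸ (hmem i).1
    have hright : ∀ i t : ZMod 3, t = i + 1 → j t ∈ marketEdge (e i) := by
      rintro i _ rfl
      exact he i ▸ (hmem i).2
    obtain ⟨h2, h3⟩ := pair_edges_mem_of_triangle (e 0) (e 1)
      (hne _ _ (by decide)) (e 2) (hne _ _ (by decide)) (hne _ _ (by decide))
      (j 0) (hleft 0) (hright 2 0 (by decide)) (hnot _ _ (by decide) (by decide))
      (j 1) (hright 0 1 (by decide)) (hleft 1) (hnot _ _ (by decide) (by decide))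
      (j 2) (hright 1 2 (by decide)) (hleft 2) (hnot _ _ (by decide) (by decide))
    have hexists : ∀ n, (e 0 = n ∨ e 1 = n ∨ e 2 = n) → ∃ i, E i = marketEdge n := by
      rintro n (rfl | rfl | rfl)
      exacts [⟨0, he 0⟩, ⟨1, he 1⟩, ⟨2, he 2⟩]
    have hunion := hCh 1 {0} {1} (hexists 2 h2) (hexists 3 h3)
    rw [show ({0} ∪ {1} : Finset (Fin 2)) = {0, 1} by decide, ch1] at hunion
    exact absurd hunion (by decide)
end
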